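/- Fix a totally real number field K₀ of class number one and degree N over ℚ, and let 0 < σ < 1. Let φ be an even Schwartz function on ℝ whose Fourier transform φ̂ is supported in (−σ, σ). For a CM-field K with maximal totally real subfield K₀ and Δ = Δ_K, define S₁(Δ, φ) = −2 · ∑_{𝔭 non-principal} log N𝔭 · ∑_{m ≥ 1, 𝔭^m principal} φ̂(m·log N𝔭 / log Δ) / N𝔭^{m/2}, where the outer sum runs over the non-principal prime ideals 𝔭 of O_K. Then there is a constant C > 0 (depending only on K₀ and φ) such that for every such CM-field K with Δ_K ≥ 16, |S₁(Δ_K, φ)| ≤ C · log log Δ_K. -/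

import Mathlib

open NumberField FourierTransform

/-- The sum `S₁(Δ, φ) = −2·∑_{𝔭 non-principal} log N𝔭 · ∑_{m ≥ 1, 𝔭^m principal}
φ̂(m·log N𝔭/log Δ)/N𝔭^{m/2}`, over the non-principal prime ideals of the ring of integers
of `K`. -/
noncomputable def S1.{v} (K : Type v) [Field K] [NumberField K]
    (φ : SchwartzMap ℝ ℂ) (Δ : ℝ) : ℂ :=
  (-2 : ℂ) * ∑' 𝔭 : {𝔭 : Ideal (𝓞 K) // 𝔭.IsPrime ∧ ¬Submodule.IsPrincipal 𝔭},
    (Real.log (Ideal.absNorm 𝔭.1) : ℂ) *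
      ∑' m : {m : ℕ // 1 ≤ m ∧ Submodule.IsPrincipal (𝔭.1 ^ (m : ℕ))},
        𝓕 ⇑φ ((m : ℝ) * Real.log (Ideal.absNorm 𝔭.1) / Real.log Δ) /
          ((((Ideal.absNorm 𝔭.1 : ℝ) ^ (((m : ℕ) : ℝ) / 2)) : ℝ) : ℂ)


theorem sum_log_div_le_two_mul_log (n : ℕ) :
    ∑ p ∈ Nat.primesLE n, Real.log p / p ≤ 2 * Real.log n := by
  rcases Nat.eq_zero_or_pos n with rfl | hn
  · simp
  have hn' : (0 : ℝ) < n := by exact_mod_cast hn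
  have key : ∀ p ∈ Nat.primesLE n,
      n * (Real.log p / p) ≤ 2 * ((n.factorial.factorization p : ℝ) * Real.log p) := by
    intro p hp
    obtain ⟨hpn, hp⟩ := Nat.mem_primesLE.1 hp
    have hp0 : (0 : ℝ) < p := by exact_mod_cast hp.pos
    have h1 : n / p ≤ n.factorial.factorization p := by
      rw [Nat.factorization_factorial hp (Nat.lt_succ_self _)]
      have hlog : 1 ≤ Nat.log p n := Nat.log_pos hp.one_lt hpn
      have := Finset.single_le_sum (f := fun i => n / p ^ i) (fun _ _ => Nat.zero_le _)
        (Finset.mem_Ico.2 ⟨le_rfl, Nat.lt_succ_of_le hlog⟩)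
      simpa using this
    have h2 : n ≤ 2 * (n / p) * p := by
      have h3 := Nat.lt_div_mul_add hp.pos (a := n)
      have h4 : 1 ≤ n / p := Nat.div_pos hpn hp.pos
      nlinarith
    have h3 : (n : ℝ) ≤ 2 * (n.factorial.factorization p : ℝ) * p := by
      calc (n : ℝ) ≤ 2 * (n / p : ℕ) * p := by exact_mod_cast h2
        _ ≤ _ := by gcongr
    have hl : 0 ≤ Real.log p := Real.log_natCast_nonneg p
    calc n * (Real.log p / p) = n / p * Real.log p := by ring
      _ ≤ (2 * (n.factorial.factorization p : ℝ)) * Real.log p := by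
        gcongr
        rwa [div_le_iff₀ hp0]
      _ = _ := by ring
  have h5 : ∑ p ∈ Nat.primesLE n, (n.factorial.factorization p : ℝ) * Real.log p
      ≤ n * Real.log n := by
    calc _ ≤ Real.log n.factorial := by
          rw [Real.log_nat_eq_sum_factorization, Finsupp.sum]
          refine Finset.sum_le_sum_of_subset_of_nonneg ?_
            fun p _ _ => mul_nonneg (Nat.cast_nonneg _) (Real.log_natCast_nonneg p)
          intro p hp
          obtain ⟨hpn, hp⟩ := Nat.mem_primesLE.1 hp
          simp [Nat.factorial_ne_zero, hp, hp.dvd_factorial, hpn]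
      _ ≤ Real.log ((n : ℝ) ^ n) := by
          apply Real.log_le_log (by exact_mod_cast n.factorial_pos)
          exact_mod_cast Nat.factorial_le_pow n
      _ = _ := by rw [Real.log_pow]
  have h6 := Finset.sum_le_sum key
  rw [← Finset.mul_sum, ← Finset.mul_sum] at h6
  refine le_of_mul_le_mul_left ?_ hn'
  linarith

theorem sum_primeFactors_log_le (n : ℕ) (hn : n ≠ 0) :
    ∑ p ∈ n.primeFactors, Real.log p ≤ Real.log n := by
  rw [Real.log_nat_eq_sum_factorization, Finsupp.sum]
  refine Finset.sum_le_sum fun p hp => ?_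
  have : 1 ≤ n.factorization p := by
    have := Nat.mem_primeFactors.1 hp
    exact (this.1.dvd_iff_one_le_factorization hn).1 this.2.1
  refine le_mul_of_one_le_left (Real.log_natCast_nonneg p) (by exact_mod_cast this)

theorem one_le_log_log {x : ℝ} (hx : 16 ≤ x) : 1 ≤ Real.log (Real.log x) := by
  have h2 := Real.log_two_gt_d9
  have h16 : Real.log 16 = 4 * Real.log 2 := by
    rw [show (16 : ℝ) = 2 ^ 4 by norm_num, Real.log_pow]; norm_num
  have h3 : Real.exp 1 ≤ Real.log x := by
    have := Real.log_le_log (by norm_num) hx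
    have := Real.exp_one_lt_d9
    linarith
  rwa [Real.le_log_iff_exp_le ((Real.exp_pos 1).trans_le h3)]

theorem sum_primeFactors_log_div_le (n : ℕ) (hn : 16 ≤ n) :
    ∑ p ∈ n.primeFactors, Real.log p / p ≤ 3 * Real.log (Real.log n) := by
  have h1 := one_le_log_log (x := n) (by exact_mod_cast hn)
  set L := Real.log n with hL
  have hL0 : 1 < L := by
    by_contra! h
    have := Real.log_nonpos (Real.log_natCast_nonneg n) h
    linarith
  rw [← Finset.sum_filter_add_sum_filter_not _ (fun p => p ≤ ⌊L⌋₊)]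
  have hA : ∑ p ∈ n.primeFactors with p ≤ ⌊L⌋₊, Real.log p / p ≤ 2 * Real.log L := by
    calc _ ≤ ∑ p ∈ Nat.primesLE ⌊L⌋₊, Real.log p / p := by
          refine Finset.sum_le_sum_of_subset_of_nonneg ?_
            fun p _ _ => div_nonneg (Real.log_natCast_nonneg p) (Nat.cast_nonneg _)
          intro p hp
          simp only [Finset.mem_filter, Nat.mem_primeFactors] at hp
          exact Nat.mem_primesLE.2 ⟨hp.2, hp.1.1⟩
      _ ≤ 2 * Real.log ⌊L⌋₊ := sum_log_div_le_two_mul_log _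
      _ ≤ _ := by
          have : 0 < ⌊L⌋₊ := Nat.floor_pos.2 hL0.le
          gcongr
          exact Nat.floor_le (by linarith)
  have hB : ∑ p ∈ n.primeFactors with ¬ p ≤ ⌊L⌋₊, Real.log p / p ≤ 1 := by
    calc _ ≤ ∑ p ∈ n.primeFactors with ¬ p ≤ ⌊L⌋₊, Real.log p / L := by
          refine Finset.sum_le_sum fun p hp => ?_
          have : L < p := (Nat.floor_lt (by linarith)).1 (not_le.1 (Finset.mem_filter.1 hp).2)
          exact div_le_div_of_nonneg_left (Real.log_natCast_nonneg p) (by linarith) this.le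
      _ ≤ ∑ p ∈ n.primeFactors, Real.log p / L :=
          Finset.sum_le_sum_of_subset_of_nonneg (Finset.filter_subset _ _)
            fun p _ _ => div_nonneg (Real.log_natCast_nonneg p) (by linarith)
      _ ≤ 1 := by
          rw [← Finset.sum_div, div_le_one (by linarith)]
          exact sum_primeFactors_log_le n (by omega)
  linarith
open Polynomial in
theorem norm_embedding_aeval_derivative_minpoly_le {K₀ K : Type*} [Field K₀] [NumberField K₀]
    [Field K] [NumberField K] [Algebra K₀ K]
    (hTR : ∀ ψ : K₀ →+* ℂ, ∀ z : K₀, (ψ z).im = 0) (h2 : Module.finrank K₀ K = 2)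
    (hTC : IsEmpty (K →+* ℝ)) (α : K) (hα : Algebra.adjoin K₀ {α} = ⊤) (ψ : K →+* ℂ) :
    ‖ψ (aeval α (derivative (minpoly K₀ α)))‖ ≤ 2 * ‖ψ α‖ := by
  have him : (ψ α).im ≠ 0 := by
    intro h0
    have hreal : ComplexEmbedding.IsReal ψ := by
      rw [ComplexEmbedding.isReal_iff]
      have hS : ∀ x ∈ Algebra.adjoin K₀ {α}, (starRingEnd ℂ) (ψ x) = ψ x := by
        intro x hx
        induction hx using Algebra.adjoin_induction with
        | mem x hx =>
          rw [Set.mem_singleton_iff.1 hx]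
          exact Complex.conj_eq_iff_im.2 h0
        | algebraMap r => exact Complex.conj_eq_iff_im.2 (hTR (ψ.comp (algebraMap K₀ K)) r)
        | add x y _ _ hx hy => simp [hx, hy]
        | mul x y _ _ hx hy => simp [hx, hy]
      ext x
      exact hS x (hα ▸ Algebra.mem_top)
    exact hTC.false hreal.embedding
  have hint : IsIntegral K₀ α := Algebra.IsIntegral.isIntegral α
  have hdeg : (minpoly K₀ α).natDegree = 2 := by
    rw [← h2, ← (Field.primitive_element_iff_minpoly_natDegree_eq K₀ α).1]
    rw [← IntermediateField.toSubalgebra_injective.eq_iff,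
      IntermediateField.adjoin_simple_toSubalgebra_of_isAlgebraic hint.isAlgebraic, hα]
    rfl
  have hmon := minpoly.monic hint
  set f := minpoly K₀ α with hf
  have hfe : f = X ^ 2 + C (f.coeff 1) * X + C (f.coeff 0) := by
    have h := f.as_sum_range_C_mul_X_pow
    have hc : f.coeff 2 = 1 := by rw [← hdeg]; exact hmon
    rw [hdeg] at h
    simp only [Finset.sum_range_succ, Finset.sum_range_zero, hc] at h
    rw [h]
    simp
    ring
  set ψ₀ := ψ.comp (algebraMap K₀ K) with hψ₀
  have hroot : (ψ α) ^ 2 + ψ₀ (f.coeff 1) * ψ α + ψ₀ (f.coeff 0) = 0 := by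
    have h : aeval α f = 0 := minpoly.aeval K₀ α
    rw [hfe] at h
    simpa [hψ₀] using congrArg ψ h
  have hder : ψ (aeval α (derivative f)) = 2 * ψ α + ψ₀ (f.coeff 1) := by
    rw [hfe]
    simp [hψ₀]
    exact Or.inl one_add_one_eq_two
  have ha := hTR ψ₀ (f.coeff 1)
  have hb := hTR ψ₀ (f.coeff 0)
  rw [hder]
  generalize ψ₀ (f.coeff 1) = a at *
  generalize ψ₀ (f.coeff 0) = b at *
  generalize ψ α = x at *
  have h3 : 2 * x.re + a.re = 0 := by
    have := congrArg Complex.im hroot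
    simp [pow_two, ha, hb] at this
    apply mul_left_cancel₀ him
    linarith
  have h4 : 2 * x + a = x - (starRingEnd ℂ) x := by
    apply Complex.ext
    · simp; linarith
    · simp [ha]; ring
  rw [h4]
  calc _ ≤ ‖x‖ + ‖(starRingEnd ℂ) x‖ := norm_sub_le _ _
    _ = _ := by rw [RCLike.norm_conj]; ring

open Polynomial in
theorem natAbs_discr_le_of_adjoin_eq_top {K₀ K : Type*} [Field K₀] [NumberField K₀]
    [Field K] [NumberField K] [Algebra K₀ K]
    (hTR : ∀ ψ : K₀ →+* ℂ, ∀ z : K₀, (ψ z).im = 0) (h2 : Module.finrank K₀ K = 2)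
    (hTC : IsEmpty (K →+* ℝ)) (α : 𝓞 K) (hα : Algebra.adjoin K₀ {(α : K)} = ⊤) :
    (discr K).natAbs ≤
      2 ^ Module.finrank ℚ K * (discr K₀).natAbs ^ 2 * Ideal.absNorm (Ideal.span {α}) := by
  set δ := aeval α (derivative (minpoly (𝓞 K₀) α)) with hδ
  have hmem : δ ∈ differentIdeal (𝓞 K₀) (𝓞 K) := aeval_derivative_mem_differentIdeal _ K₀ K α hα
  have hδK : (δ : K) = aeval (α : K) (derivative (minpoly K₀ (α : K))) := by
    have hi : IsIntegral (𝓞 K₀) α := Algebra.IsIntegral.isIntegral α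
    have : minpoly K₀ (α : K) = _ := minpoly.isIntegrallyClosed_eq_field_fractions K₀ K hi
    rw [this, derivative_map, aeval_map_algebraMap, aeval_algebraMap_apply]
  have hne : δ ≠ 0 := by
    intro h0
    rw [h0] at hδK
    exact (Algebra.IsSeparable.isSeparable K₀ (α : K)).aeval_derivative_ne_zero
      (minpoly.aeval _ _) hδK.symm
  have hnorm : ∀ x : 𝓞 K, (Ideal.absNorm (Ideal.span {x}) : ℝ) = ∏ σ : K →ₐ[ℚ] ℂ, ‖σ x‖ := by
    intro x
    rw [← norm_prod, ← Algebra.norm_eq_prod_embeddings ℚ ℂ (x : K), Ideal.absNorm_span_singleton,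
      ← Algebra.coe_norm_int]
    simp
  have h1 : Ideal.absNorm (differentIdeal (𝓞 K₀) (𝓞 K)) ≤ Ideal.absNorm (Ideal.span {δ}) := by
    refine Nat.le_of_dvd ?_ (Ideal.absNorm_dvd_absNorm_of_le
      ((Ideal.span_singleton_le_iff_mem _).2 hmem))
    exact Nat.pos_of_ne_zero (by simpa [Ideal.absNorm_eq_zero_iff] using hne)
  have h3 : Ideal.absNorm (Ideal.span {δ}) ≤
      2 ^ Module.finrank ℚ K * Ideal.absNorm (Ideal.span {α}) := by
    have : (Ideal.absNorm (Ideal.span {δ}) : ℝ) ≤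
        2 ^ Module.finrank ℚ K * Ideal.absNorm (Ideal.span {α}) := by
      rw [hnorm, hnorm, ← AlgHom.card ℚ K ℂ, ← Finset.card_univ, ← Finset.prod_const,
        ← Finset.prod_mul_distrib]
      refine Finset.prod_le_prod (fun _ _ => norm_nonneg _) fun σ _ => ?_
      rw [hδK]
      exact norm_embedding_aeval_derivative_minpoly_le hTR h2 hTC α hα σ.toRingHom
    exact_mod_cast this
  rw [natAbs_discr_eq_absNorm_differentIdeal_mul_natAbs_discr_pow K₀ (𝓞 K₀) K (𝓞 K), h2]
  nlinarith [Nat.zero_le ((discr K₀).natAbs ^ 2), Nat.mul_le_mul_right ((discr K₀).natAbs ^ 2) (h1.trans h3)]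
theorem absNorm_under_dvd_discr_of_pow_eq_span {K₀ K : Type*} [Field K₀] [NumberField K₀]
    [Field K] [NumberField K] [Algebra K₀ K] [IsPrincipalIdealRing (𝓞 K₀)]
    (𝔭 : Ideal (𝓞 K)) [𝔭.IsPrime] (hnp : ¬ 𝔭.IsPrincipal) {m : ℕ} (hm : m ≠ 0) (a : 𝓞 K₀)
    (ha : 𝔭 ^ m = Ideal.span {algebraMap (𝓞 K₀) (𝓞 K) a}) :
    Ideal.absNorm (𝔭.under ℤ) ∣ (discr K).natAbs := by
  have h0 : 𝔭 ≠ ⊥ := by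
    rintro rfl
    exact hnp inferInstance
  have hprime : Prime 𝔭 := Ideal.prime_of_isPrime h0 inferInstance
  have : 𝔭.IsMaximal := Ideal.IsPrime.isMaximal inferInstance h0
  set P := 𝔭.under (𝓞 K₀) with hP
  have haP : a ∈ P := by
    have : algebraMap (𝓞 K₀) (𝓞 K) a ∈ 𝔭 ^ m := ha ▸ Ideal.mem_span_singleton_self _
    exact Ideal.mem_comap.2 (Ideal.pow_le_self hm this)
  have hdvd : P.map (algebraMap (𝓞 K₀) (𝓞 K)) ∣ 𝔭 ^ m := by
    rw [Ideal.dvd_iff_le, ha, Ideal.span_singleton_le_iff_mem]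
    exact Ideal.mem_map_of_mem _ haP
  obtain ⟨e, -, he⟩ := (dvd_prime_pow hprime m).1 hdvd
  rw [associated_iff_eq] at he
  have hPle : P.map (algebraMap (𝓞 K₀) (𝓞 K)) ≤ 𝔭 := Ideal.map_le_iff_le_comap.2 le_rfl
  have he0 : e ≠ 0 := by
    rintro rfl
    rw [he, pow_zero, Ideal.one_eq_top, top_le_iff] at hPle
    exact Ideal.IsPrime.ne_top inferInstance hPle
  have he1 : e ≠ 1 := by
    rintro rfl
    rw [pow_one] at he
    obtain ⟨π, hπ⟩ := IsPrincipalIdealRing.principal P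
    apply hnp
    rw [← he, hπ]
    exact ⟨algebraMap (𝓞 K₀) (𝓞 K) π, by
      rw [← Ideal.span, ← Ideal.span, Ideal.map_span, Set.image_singleton]⟩
  have hsq : 𝔭 ^ 2 ∣ (𝔭.under ℤ).map (algebraMap ℤ (𝓞 K)) := by
    refine (pow_dvd_pow 𝔭 (by omega : 2 ≤ e)).trans ?_
    rw [← he, Ideal.dvd_iff_le, IsScalarTower.algebraMap_eq ℤ (𝓞 K₀) (𝓞 K), ← Ideal.map_map]
    refine Ideal.map_mono (Ideal.map_le_iff_le_comap.2 ?_)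
    rw [hP, ← Ideal.under_def, Ideal.under_under]
  have hbot : 𝔭.under ℤ ≠ ⊥ := Ideal.under_ne_bot ℤ h0
  have hd := pow_sub_one_dvd_differentIdeal ℤ 𝔭 2 hbot hsq
  rw [show 2 - 1 = 1 from rfl, pow_one] at hd
  rw [← absNorm_differentIdeal K (𝓞 K)]
  exact (Int.absNorm_under_dvd_absNorm 𝔭).trans (map_dvd Ideal.absNorm hd)

theorem natAbs_discr_le_or_absNorm_under_dvd {K₀ K : Type*} [Field K₀] [NumberField K₀]
    [Field K] [NumberField K] [Algebra K₀ K] [IsPrincipalIdealRing (𝓞 K₀)]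
    (hTR : ∀ ψ : K₀ →+* ℂ, ∀ z : K₀, (ψ z).im = 0) (h2 : Module.finrank K₀ K = 2)
    (hTC : IsEmpty (K →+* ℝ))
    (𝔭 : Ideal (𝓞 K)) [𝔭.IsPrime] (hnp : ¬ 𝔭.IsPrincipal) {m : ℕ} (hm : m ≠ 0)
    (hprin : (𝔭 ^ m).IsPrincipal) :
    (discr K).natAbs ≤
      2 ^ Module.finrank ℚ K * (discr K₀).natAbs ^ 2 * Ideal.absNorm 𝔭 ^ m ∨
    Ideal.absNorm (𝔭.under ℤ) ∣ (discr K).natAbs := by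
  obtain ⟨α, hα⟩ := hprin
  change 𝔭 ^ m = Ideal.span {α} at hα
  by_cases hbot : (α : K) ∈ (⊥ : Subalgebra K₀ K)
  · obtain ⟨x, hx⟩ := Algebra.mem_bot.1 hbot
    have hxi : IsIntegral ℤ x := by
      rw [← isIntegral_algebraMap_iff (FaithfulSMul.algebraMap_injective K₀ K), hx]
      exact α.2
    right
    refine absNorm_under_dvd_discr_of_pow_eq_span 𝔭 hnp hm (⟨x, hxi⟩ : 𝓞 K₀) ?_
    rw [hα]
    congr 2
    ext
    exact hx.symm
  · left
    have := Subalgebra.isSimpleOrder_of_finrank_prime K₀ K (h2 ▸ Nat.prime_two)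
    have htop : Algebra.adjoin K₀ {(α : K)} = ⊤ := by
      refine (eq_bot_or_eq_top _).resolve_left fun h => hbot ?_
      rw [← h]
      exact Algebra.subset_adjoin rfl
    rw [← map_pow, hα]
    exact natAbs_discr_le_of_adjoin_eq_top hTR h2 hTC α htop

theorem card_primes_le_finrank {K : Type*} [Field K] [NumberField K] {p : ℕ} (hp : p.Prime)
    (s : Finset (Ideal (𝓞 K))) (hs : ∀ 𝔭 ∈ s, 𝔭.IsPrime)
    (hsp : ∀ 𝔭 ∈ s, Ideal.absNorm (𝔭.under ℤ) = p) : s.card ≤ Module.finrank ℚ K := by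
  have h0 : ∀ 𝔭 ∈ s, 𝔭 ≠ ⊥ := by
    rintro 𝔭 h𝔭 rfl
    have := hsp _ h𝔭
    simp [Ideal.under_bot] at this
    exact hp.ne_zero this.symm
  have hdvd : ∏ 𝔭 ∈ s, 𝔭 ∣ Ideal.span {(p : 𝓞 K)} := by
    refine Finset.prod_primes_dvd _ (fun 𝔭 h => Ideal.prime_of_isPrime (h0 𝔭 h) (hs 𝔭 h)) ?_
    intro 𝔭 h
    rw [Ideal.dvd_iff_le, Ideal.span_singleton_le_iff_mem, ← hsp 𝔭 h]
    exact_mod_cast Int.absNorm_under_mem 𝔭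
  have h1 := map_dvd Ideal.absNorm hdvd
  rw [map_prod] at h1
  have h2 : p ^ s.card ≤ ∏ 𝔭 ∈ s, Ideal.absNorm 𝔭 := by
    refine Finset.pow_card_le_prod s _ p fun 𝔭 h => ?_
    refine Nat.le_of_dvd (Nat.pos_of_ne_zero (Ideal.absNorm_eq_zero_iff.not.2 (h0 𝔭 h))) ?_
    rw [← hsp 𝔭 h]
    exact Int.absNorm_under_dvd_absNorm 𝔭
  have h3 : Ideal.absNorm (Ideal.span {(p : 𝓞 K)}) = p ^ Module.finrank ℚ K := by
    rw [← RingOfIntegers.rank K]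
    exact Ideal.absNorm_span_natCast p
  rw [h3] at h1
  exact (Nat.pow_le_pow_iff_right hp.one_lt).1
    (h2.trans (Nat.le_of_dvd (pow_pos hp.pos _) h1))

theorem log_div_le_two_mul_log_div_of_dvd {p q : ℕ} (hp : 2 ≤ p) (hq : 0 < q) (h : p ∣ q) :
    Real.log q / q ≤ 2 * (Real.log p / p) := by
  obtain ⟨k, rfl⟩ := h
  have hk : 0 < k := Nat.pos_of_mul_pos_left hq
  have hp' : (2 : ℝ) ≤ p := by exact_mod_cast hp
  have hk' : (1 : ℝ) ≤ k := by exact_mod_cast hk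
  have hlp : 1 / 2 ≤ Real.log p := by
    have := Real.log_two_gt_d9
    have := Real.log_le_log (by norm_num) hp'
    linarith
  have hlk : Real.log k ≤ k - 1 := Real.log_le_sub_one_of_pos (by linarith)
  have h1 : Real.log p + Real.log k ≤ 2 * k * Real.log p := by nlinarith
  push_cast
  rw [Real.log_mul (by positivity) (by positivity), div_le_iff₀ (by positivity)]
  calc _ ≤ 2 * k * Real.log p := h1
    _ = _ := by field_simp

theorem norm_tsum_pow_div_le {s : ℕ → Prop} (hs : ∀ m, s m → 2 ≤ m) (f : ℝ → ℂ) {M : ℝ}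
    (hM : ∀ x, ‖f x‖ ≤ M) (c : ℕ → ℝ) {q : ℝ} (hq : 2 ≤ q) :
    ‖∑' m : {m : ℕ // s m}, f (c m) / (((q ^ (((m : ℕ) : ℝ) / 2)) : ℝ) : ℂ)‖ ≤ 4 * M / q := by
  have hM0 : 0 ≤ M := (norm_nonneg _).trans (hM 0)
  have hq0 : 0 < q := by linarith
  set r : ℝ := (√q)⁻¹ with hr
  have hsq : 4 / 3 ≤ √q := Real.le_sqrt_of_sq_le (by linarith)
  have hr0 : 0 < r := by positivity
  have hr1 : r ≤ 3 / 4 := by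
    rw [hr, inv_le_comm₀ (by linarith) (by norm_num)]
    norm_num
    exact hsq
  have hr2 : r ^ 2 = q⁻¹ := by rw [hr, inv_pow, Real.sq_sqrt hq0.le]
  have hg : HasSum (fun k : ℕ => M * q⁻¹ * r ^ k) (M * q⁻¹ * (1 - r)⁻¹) :=
    (hasSum_geometric_of_lt_one hr0.le (by linarith)).mul_left _
  set e : {m : ℕ // s m} → ℕ := fun m => m.1 - 2 with he
  have hinj : Function.Injective e := by
    intro a b hab
    have h1 := hs _ a.2
    have h2 := hs _ b.2
    simp only [he] at hab
    exact Subtype.ext (by omega)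
  have hsum := hg.summable.comp_injective hinj
  have hle : ∑' m, ((fun k : ℕ => M * q⁻¹ * r ^ k) ∘ e) m ≤ M * q⁻¹ * (1 - r)⁻¹ := by
    rw [← hg.tsum_eq]
    exact tsum_comp_le_tsum_of_inj hg.summable (fun k => by positivity) hinj
  calc _ ≤ ∑' m, ((fun k : ℕ => M * q⁻¹ * r ^ k) ∘ e) m := by
        refine tsum_of_norm_bounded hsum.hasSum fun m => ?_
        have hm : m.1 = e m + 2 := by have := hs _ m.2; simp only [he]; omega
        have hpow : q ^ (((m : ℕ) : ℝ) / 2) = (r ^ m.1)⁻¹ := by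
          rw [hr, inv_pow, inv_inv, Real.sqrt_eq_rpow, ← Real.rpow_natCast, ← Real.rpow_mul hq0.le]
          congr 1
          ring
        rw [hpow, norm_div, Complex.norm_real, Real.norm_of_nonneg (by positivity), div_inv_eq_mul,
          Function.comp_apply]
        calc _ ≤ M * r ^ m.1 := by gcongr; exact hM _
          _ = M * q⁻¹ * r ^ e m := by rw [hm, pow_add, hr2]; ring
    _ ≤ M * q⁻¹ * (1 - r)⁻¹ := hle
    _ ≤ M * q⁻¹ * 4 := by
        gcongr
        rw [inv_le_comm₀ (by linarith) (by norm_num)]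
        linarith
    _ = _ := by ring

theorem norm_tsum_le_of_fiber_card_le {ι : Type*} (f : ι → ℂ) (π : ι → ℕ) (A : Finset ℕ) (g : ℕ → ℝ)
    (n : ℕ) (hg : ∀ p, 0 ≤ g p) (hA : ∀ i, f i ≠ 0 → π i ∈ A) (hf : ∀ i, ‖f i‖ ≤ g (π i))
    (hn : ∀ p ∈ A, ∀ s : Finset ι, (∀ i ∈ s, π i = p) → s.card ≤ n) :
    ‖∑' i, f i‖ ≤ n * ∑ p ∈ A, g p := by
  have hB : ∀ s : Finset ι, ∑ i ∈ s, ‖f i‖ ≤ n * ∑ p ∈ A, g p := by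
    intro s
    calc ∑ i ∈ s, ‖f i‖ = ∑ i ∈ s with π i ∈ A, ‖f i‖ := by
          refine (Finset.sum_filter_of_ne fun i _ h => hA i ?_).symm
          simpa using h
      _ = ∑ p ∈ A, ∑ i ∈ s.filter (π · ∈ A) with π i = p, ‖f i‖ :=
          (Finset.sum_fiberwise_of_maps_to (fun i hi => (Finset.mem_filter.1 hi).2) _).symm
      _ ≤ ∑ p ∈ A, n * g p := by
          refine Finset.sum_le_sum fun p hp => ?_
          refine (Finset.sum_le_card_nsmul _ _ (g p) fun i hi => ?_).trans ?_
          · rw [← (Finset.mem_filter.1 hi).2]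
            exact hf i
          · rw [nsmul_eq_mul]
            gcongr
            · exact hg p
            · exact hn p hp _ fun i hi => (Finset.mem_filter.1 hi).2
      _ = _ := (Finset.mul_sum _ _ _).symm
  have hs : Summable fun i => ‖f i‖ := summable_of_sum_le (fun _ => norm_nonneg _) hB
  exact (norm_tsum_le_tsum_norm hs).trans (hs.tsum_le_of_sum_le hB)

theorem ne_bot_of_not_isPrincipal {R : Type*} [CommRing R] {I : Ideal R}
    (h : ¬ I.IsPrincipal) : I ≠ ⊥ := by
  rintro rfl
  exact h inferInstance

theorem prime_absNorm_under {K : Type*} [Field K] [NumberField K] {𝔭 : Ideal (𝓞 K)}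
    [𝔭.IsPrime] (h : 𝔭 ≠ ⊥) : (Ideal.absNorm (𝔭.under ℤ)).Prime :=
  have : NeZero 𝔭 := ⟨h⟩
  Nat.absNorm_under_prime 𝔭

/-- fix a totally real number field `K₀` of class number one and degree `N`,
`0 < σ < 1`, and an even Schwartz function `φ` with `supp(φ̂) ⊆ (−σ, σ)`. There is a
constant `C > 0` (depending only on `K₀` and `φ`) such that for every CM-field `K` with
maximal totally real subfield `K₀` and `Δ_K ≥ 16`, `|S₁(Δ_K, φ)| ≤ C·log log Δ_K`. -/
theorem stmt_10.{u, v} (K₀ : Type u) [Field K₀] [NumberField K₀] (N : ℕ)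
    (hN : Module.finrank ℚ K₀ = N)
    (hTR : ∀ ψ : K₀ →+* ℂ, ∀ z : K₀, (ψ z).im = 0)
    (hcl : NumberField.classNumber K₀ = 1)
    (σ : ℝ) (hσ0 : 0 < σ) (hσ1 : σ < 1)
    (φ : SchwartzMap ℝ ℂ) (heven : ∀ x : ℝ, φ (-x) = φ x)
    (hsupp : Function.support (𝓕 ⇑φ) ⊆ Set.Ioo (-σ) σ) :
    ∃ C : ℝ, 0 < C ∧
      ∀ (K : Type v) [Field K] [NumberField K] [Algebra K₀ K],
        Module.finrank K₀ K = 2 →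
        IsEmpty (K →+* ℝ) →
        (16 : ℝ) ≤ ((NumberField.discr K).natAbs : ℝ) →
        ‖S1 K φ ((NumberField.discr K).natAbs : ℝ)‖ ≤
          C * Real.log (Real.log ((NumberField.discr K).natAbs : ℝ)) := by
  obtain ⟨M, hM0, hM⟩ : ∃ M : ℝ, 0 < M ∧ ∀ x, ‖𝓕 ⇑φ x‖ ≤ M :=
    ⟨(∫ x, ‖φ x‖) + 1, by positivity, fun x =>
      (VectorFourier.norm_fourierIntegral_le_integral_norm _ _ _ _ _).trans (by simp)⟩
  have hPID : IsPrincipalIdealRing (𝓞 K₀) := classNumber_eq_one_iff.1 hcl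
  set c : ℝ := 2 ^ (2 * N) * ((discr K₀).natAbs : ℝ) ^ 2 with hc
  have hc0 : 0 < c := by
    have : (0 : ℝ) < (discr K₀).natAbs := by
      exact_mod_cast Int.natAbs_pos.2 (discr_ne_zero K₀)
    positivity
  set B : ℕ := ⌊c ^ (1 - σ)⁻¹⌋₊ with hB
  set D : ℝ := ∑ p ∈ Nat.primesLE B, Real.log p / p with hD
  have hterm (p : ℕ) : 0 ≤ Real.log p / p :=
    div_nonneg (Real.log_natCast_nonneg p) (Nat.cast_nonneg p)
  have hD0 : 0 ≤ D := Finset.sum_nonneg fun p _ => hterm p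
  refine ⟨16 * M * (2 * N) * (3 + D) + 1, by positivity, ?_⟩
  intro K _ _ _ h2 hTC hΔ
  have hfin : Module.finrank ℚ K = 2 * N := by
    rw [← Module.finrank_mul_finrank ℚ K₀ K, hN, h2, mul_comm]
  have hLL := one_le_log_log hΔ
  have hΔn : 16 ≤ (discr K).natAbs := by exact_mod_cast hΔ
  have hsumΔ := sum_primeFactors_log_div_le _ hΔn
  set d : ℕ := (discr K).natAbs with hd
  have hlogd : 0 < Real.log d := Real.log_pos (by linarith)
  set A : Finset ℕ := d.primeFactors ∪ Nat.primesLE B with hA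
  have hAprime : ∀ p ∈ A, p.Prime := by
    intro p hp
    rcases Finset.mem_union.1 hp with h | h
    · exact Nat.prime_of_mem_primeFactors h
    · exact (Nat.mem_primesLE.1 h).2
  have hmain : ‖S1 K φ d‖ ≤
      2 * ((2 * N : ℕ) * ∑ p ∈ A, 8 * M * (Real.log p / p)) := by
    rw [S1, norm_mul, norm_neg, Complex.norm_two]
    gcongr
    refine norm_tsum_le_of_fiber_card_le _
      (fun 𝔭 : {𝔭 : Ideal (𝓞 K) // 𝔭.IsPrime ∧ ¬Submodule.IsPrincipal 𝔭} =>
        Ideal.absNorm (𝔭.1.under ℤ)) A _ (2 * N) ?_ ?_ ?_ ?_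
    · exact fun p => mul_nonneg (by positivity) (hterm p)
    · rintro ⟨𝔭, hprime, hnp⟩ hne
      obtain ⟨m, hm⟩ : ∃ m : {m : ℕ // 1 ≤ m ∧ Submodule.IsPrincipal (𝔭 ^ (m : ℕ))},
          𝓕 ⇑φ ((m : ℝ) * Real.log (Ideal.absNorm 𝔭) / Real.log d) ≠ 0 := by
        by_contra! h
        exact hne (by simp [h])
      obtain ⟨m, hm1, hprin⟩ := m
      have hbot := ne_bot_of_not_isPrincipal hnp
      have hp := prime_absNorm_under hbot
      have hdvd := Int.absNorm_under_dvd_absNorm 𝔭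
      rcases natAbs_discr_le_or_absNorm_under_dvd hTR h2 hTC 𝔭 hnp (by omega : m ≠ 0) hprin
        with h | h
      · refine Finset.mem_union_right _ (Nat.mem_primesLE.2 ⟨Nat.le_floor ?_, hp⟩)
        set q := Ideal.absNorm 𝔭
        have hq0 : 0 < q := Nat.pos_of_ne_zero (Ideal.absNorm_eq_zero_iff.not.2 hbot)
        have hq0' : (0 : ℝ) < q := by exact_mod_cast hq0
        have hlq : 0 ≤ Real.log q := Real.log_natCast_nonneg q
        have hlt : m * Real.log q < σ * Real.log d := (div_lt_iff₀ hlogd).1 (hsupp hm).2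
        have hqm : Real.log q ≤ m * Real.log q :=
          le_mul_of_one_le_left hlq (by exact_mod_cast hm1)
        have hqd : (q : ℝ) ≤ d := by
          rw [← Real.log_le_log_iff hq0' (by linarith)]
          nlinarith
        have hdc : (d : ℝ) ≤ c ^ (1 - σ)⁻¹ := by
          have h' : (d : ℝ) ≤ c * (q : ℝ) ^ m := by
            rw [hfin] at h
            rw [hc]
            exact_mod_cast h
          have hlog := Real.log_le_log (by linarith) h'
          rw [Real.log_mul hc0.ne' (by positivity), Real.log_pow] at hlog
          rw [← Real.log_le_log_iff (by linarith) (by positivity), Real.log_rpow hc0,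
            inv_mul_eq_div, le_div_iff₀ (by linarith)]
          nlinarith
        calc ((Ideal.absNorm (𝔭.under ℤ) : ℕ) : ℝ) ≤ q := by exact_mod_cast Nat.le_of_dvd hq0 hdvd
          _ ≤ _ := hqd.trans hdc
      · exact Finset.mem_union_left _ (Nat.mem_primeFactors.2 ⟨hp, h, by omega⟩)
    · rintro ⟨𝔭, hprime, hnp⟩
      have hbot := ne_bot_of_not_isPrincipal hnp
      have hp := prime_absNorm_under hbot
      have hdvd := Int.absNorm_under_dvd_absNorm 𝔭
      have hq0 : 0 < Ideal.absNorm 𝔭 := Nat.pos_of_ne_zero (Ideal.absNorm_eq_zero_iff.not.2 hbot)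
      have hq2 : (2 : ℝ) ≤ Ideal.absNorm 𝔭 := by
        exact_mod_cast hp.two_le.trans (Nat.le_of_dvd hq0 hdvd)
      have hm2 (m : ℕ) (hm : 1 ≤ m ∧ Submodule.IsPrincipal (𝔭 ^ m)) : 2 ≤ m := by
        by_contra! hlt
        obtain rfl : m = 1 := by omega
        exact hnp (by simpa using hm.2)
      have hinner := norm_tsum_pow_div_le hm2 (𝓕 ⇑φ) hM
        (fun m => (m : ℝ) * Real.log (Ideal.absNorm 𝔭) / Real.log d) hq2
      have hlog := log_div_le_two_mul_log_div_of_dvd hp.two_le hq0 hdvd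
      have hlq : 0 ≤ Real.log (Ideal.absNorm 𝔭) := Real.log_natCast_nonneg _
      rw [norm_mul, Complex.norm_real, Real.norm_of_nonneg hlq]
      refine (mul_le_mul_of_nonneg_left hinner hlq).trans ?_
      calc _ = 4 * M * (Real.log (Ideal.absNorm 𝔭) / Ideal.absNorm 𝔭) := by ring
        _ ≤ 4 * M * (2 * (Real.log (Ideal.absNorm (𝔭.under ℤ)) / Ideal.absNorm (𝔭.under ℤ))) := by
          gcongr
        _ = _ := by ring
    · intro p hp s hs
      rw [← hfin, ← Finset.card_map (Function.Embedding.subtype _)]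
      refine card_primes_le_finrank (hAprime p hp) _ ?_ ?_
      · intro 𝔭 h
        obtain ⟨i, -, rfl⟩ := Finset.mem_map.1 h
        exact i.2.1
      · intro 𝔭 h
        obtain ⟨i, hi, rfl⟩ := Finset.mem_map.1 h
        exact hs i hi
  have hA_le : ∑ p ∈ A, 8 * M * (Real.log p / p) ≤ 8 * M * (3 * Real.log (Real.log d) + D) := by
    rw [← Finset.mul_sum]
    gcongr
    have hui := Finset.sum_union_inter (s₁ := d.primeFactors) (s₂ := Nat.primesLE B)
      (f := fun p : ℕ => Real.log p / p)
    have hi : 0 ≤ ∑ p ∈ d.primeFactors ∩ Nat.primesLE B, Real.log p / p :=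
      Finset.sum_nonneg fun p _ => hterm p
    linarith
  calc ‖S1 K φ d‖ ≤ 2 * ((2 * N : ℕ) * ∑ p ∈ A, 8 * M * (Real.log p / p)) := hmain
    _ ≤ 2 * ((2 * N : ℕ) * (8 * M * (3 * Real.log (Real.log d) + D))) := by gcongr
    _ ≤ 2 * ((2 * N : ℕ) * (8 * M * ((3 + D) * Real.log (Real.log d)))) := by
        gcongr
        nlinarith
    _ = 16 * M * (2 * N) * (3 + D) * Real.log (Real.log d) := by push_cast; ring
    _ ≤ _ := by
        gcongr
        linarith
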